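/- Every graded two-sided ideal Ĩ of A equals the k-linear span of the set of products {c·b : c ∈ C, b ∈ Ĩ ∩ B}, where C is the unital subalgebra of A generated by x₁, …, xₙ; moreover the assignment Ĩ ↦ Ĩ ∩ B is a bijection from the set of graded two-sided ideals of A onto the set of graded two-sided ideals of B. -/

import Mathlib

section Supercentralizer

variable {k A ι : Type*} [Field k] [Ring A] [Algebra k A]

/-- The involutive conjugation `a ↦ y * σ a * y` attached to a square-one element `y`. -/
def twistedConj (σ : A →ₐ[k] A) (y : A) (hy : y * y = 1) : A →ₐ[k] A :=
  AlgHom.ofLinearMap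
    (LinearMap.mulLeft k y ∘ₗ LinearMap.mulRight k y ∘ₗ σ.toLinearMap)
    (by simp [hy])
    (fun a b => by
      have h : y * (σ a * y) * (y * (σ b * y)) = y * (σ a * (y * y) * (σ b * y)) := by
        noncomm_ring
      simp [h, hy, mul_assoc])

theorem twistedConj_apply (σ : A →ₐ[k] A) (y : A) (hy : y * y = 1) (a : A) :
    twistedConj σ y hy a = y * (σ a * y) := rfl

theorem twistedConj_eq_self_iff (σ : A →ₐ[k] A) (y : A) (hy : y * y = 1) (a : A) :
    twistedConj σ y hy a = a ↔ y * a = σ a * y := by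
  rw [twistedConj_apply]
  constructor
  · intro h
    conv_lhs => rw [← h]
    rw [← mul_assoc, hy, one_mul]
  · intro h
    rw [← h, ← mul_assoc, hy, one_mul]

/-- The elements `a` with `x i * a = σ a * x i` for all `i`. When `σ` is the parity automorphism
and the `x i` are odd this is their joint supercentralizer. -/
def supercentralizer (σ : A →ₐ[k] A) (x : ι → A) : Subalgebra k A where
  carrier := {a | ∀ i, x i * a = σ a * x i}
  mul_mem' {a b} ha hb i := by
    rw [← mul_assoc, ha i, mul_assoc, hb i, map_mul, mul_assoc]
  add_mem' {a b} ha hb i := by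
    rw [mul_add, ha i, hb i, map_add, add_mul]
  algebraMap_mem' r i := by
    rw [AlgHom.commutes, Algebra.commutes]

theorem mem_supercentralizer {σ : A →ₐ[k] A} {x : ι → A} {a : A} :
    a ∈ supercentralizer σ x ↔ ∀ i, x i * a = σ a * x i := Iff.rfl

theorem map_mem_supercentralizer {σ : A →ₐ[k] A} {x : ι → A}
    (hσx : ∀ i, σ (x i) = -x i) {a : A} (ha : a ∈ supercentralizer σ x) :
    σ a ∈ supercentralizer σ x := by
  intro i
  have h := congrArg σ (ha i)
  simpa [hσx] using h

theorem Algebra.mul_mem_of_mem_adjoin_left {S : Set A} {N : Submodule k A}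
    (hN : ∀ s ∈ S, ∀ m ∈ N, s * m ∈ N) {c : A} (hc : c ∈ Algebra.adjoin k S) :
    ∀ m ∈ N, c * m ∈ N := by
  induction hc using Algebra.adjoin_induction with
  | mem s hs => exact hN s hs
  | algebraMap r => intro m hm; rw [← Algebra.smul_def]; exact N.smul_mem r hm
  | add a b _ _ ha hb => intro m hm; rw [add_mul]; exact N.add_mem (ha m hm) (hb m hm)
  | mul a b _ _ ha hb => intro m hm; rw [mul_assoc]; exact ha _ (hb m hm)

theorem Algebra.mul_mem_of_mem_adjoin_right {S : Set A} {N : Submodule k A}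
    (hN : ∀ s ∈ S, ∀ m ∈ N, m * s ∈ N) {c : A} (hc : c ∈ Algebra.adjoin k S) :
    ∀ m ∈ N, m * c ∈ N := by
  induction hc using Algebra.adjoin_induction with
  | mem s hs => exact hN s hs
  | algebraMap r =>
    intro m hm; rw [← Algebra.commutes, ← Algebra.smul_def]; exact N.smul_mem r hm
  | add a b _ _ ha hb => intro m hm; rw [mul_add]; exact N.add_mem (ha m hm) (hb m hm)
  | mul a b _ _ ha hb => intro m hm; rw [← mul_assoc]; exact hb _ (ha m hm)

theorem twistedConj_generator_of_ne {σ : A →ₐ[k] A} {x : ι → A} (hσx : ∀ i, σ (x i) = -x i)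
    (hxx : ∀ i, x i * x i = 1) (hanti : ∀ i j, i ≠ j → x i * x j = -(x j * x i))
    {i j : ι} (hij : i ≠ j) : twistedConj σ (x i) (hxx i) (x j) = x j := by
  rw [twistedConj_eq_self_iff, hσx, hanti i j hij, neg_mul]

theorem twistedConj_generator_self {σ : A →ₐ[k] A} {x : ι → A} (hσx : ∀ i, σ (x i) = -x i)
    (hxx : ∀ i, x i * x i = 1) (i : ι) : twistedConj σ (x i) (hxx i) (x i) = -x i := by
  rw [twistedConj_apply, hσx, neg_mul, hxx, mul_neg, mul_one]

theorem twistedConj_twistedConj {σ : A →ₐ[k] A} {y : A} (hσσ : ∀ a, σ (σ a) = a)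
    (hσy : σ y = -y) (hy : y * y = 1) (a : A) :
    twistedConj σ y hy (twistedConj σ y hy a) = a := by
  simp only [twistedConj_apply]
  simp only [map_mul, hσσ, hσy, mul_neg, neg_mul, neg_neg]
  have h : y * (y * (a * y) * y) = y * y * a * (y * y) := by noncomm_ring
  rw [h, hy, one_mul, mul_one]

theorem twistedConj_comm {σ : A →ₐ[k] A} {x : ι → A} (hσσ : ∀ a, σ (σ a) = a)
    (hσx : ∀ i, σ (x i) = -x i)
    (hxx : ∀ i, x i * x i = 1) (hanti : ∀ i j, i ≠ j → x i * x j = -(x j * x i))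
    {i j : ι} (hij : i ≠ j) (a : A) :
    twistedConj σ (x i) (hxx i) (twistedConj σ (x j) (hxx j) a) =
      twistedConj σ (x j) (hxx j) (twistedConj σ (x i) (hxx i) a) := by
  simp only [twistedConj_apply]
  simp only [map_mul, hσσ, hσx, mul_neg, neg_mul, neg_neg]
  have h1 : x i * (x j * (a * x j) * x i) = (x i * x j) * a * (x j * x i) := by noncomm_ring
  have h2 : x j * (x i * (a * x i) * x j) = (x j * x i) * a * (x i * x j) := by noncomm_ring
  rw [h1, h2, hanti i j hij]
  noncomm_ring

/-- A subspace stable under `σ` and under multiplication by the `x i` is generated, as a left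
module over the algebra of the `x i`, by its elements in the supercentralizer. -/
theorem le_adjoin_mul_inf_supercentralizer [Finite ι] (h2 : (2 : k) ≠ 0)
    {σ : A →ₐ[k] A} {x : ι → A} (hσσ : ∀ a, σ (σ a) = a) (hσx : ∀ i, σ (x i) = -x i)
    (hxx : ∀ i, x i * x i = 1) (hanti : ∀ i j, i ≠ j → x i * x j = -(x j * x i))
    {I : Submodule k A} (hIσ : ∀ a ∈ I, σ a ∈ I) (hIl : ∀ i, ∀ a ∈ I, x i * a ∈ I)
    (hIr : ∀ i, ∀ a ∈ I, a * x i ∈ I) :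
    I ≤ Subalgebra.toSubmodule (Algebra.adjoin k (Set.range x)) *
      (I ⊓ Subalgebra.toSubmodule (supercentralizer σ x)) := by
  classical
  have := Fintype.ofFinite ι
  set C := Algebra.adjoin k (Set.range x)
  set V := Subalgebra.toSubmodule C * (I ⊓ Subalgebra.toSubmodule (supercentralizer σ x)) with hV
  have hxC : ∀ i, x i ∈ C := fun i => Algebra.subset_adjoin ⟨i, rfl⟩
  have hxV : ∀ i, ∀ v ∈ V, x i * v ∈ V := by
    intro i v hv
    have h : x i * v ∈ Subalgebra.toSubmodule C * V := Submodule.mul_mem_mul (hxC i) hv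
    rwa [hV, ← mul_assoc, (Subalgebra.isIdempotentElem_toSubmodule _).eq] at h
  suffices key : ∀ s : Finset ι, ∀ a ∈ I,
      (∀ j ∉ s, twistedConj σ (x j) (hxx j) a = a) → a ∈ V from
    fun a ha => key Finset.univ a ha (fun j hj => absurd (Finset.mem_univ j) hj)
  intro s
  induction s using Finset.induction_on with
  | empty =>
    intro a ha h
    rw [← one_mul a]
    refine Submodule.mul_mem_mul C.one_mem ⟨ha, ?_⟩
    exact fun i => (twistedConj_eq_self_iff σ _ (hxx i) a).1 (h i (Finset.notMem_empty i))
  | insert i s his ih =>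
    intro a ha h
    set θ := twistedConj σ (x i) (hxx i)
    have hθ : ∀ b, θ (θ b) = b := twistedConj_twistedConj hσσ (hσx i) (hxx i)
    have hθa : θ a ∈ I := hIl i _ (hIr i _ (hIσ a ha))
    have hp : (2 : k)⁻¹ • (a + θ a) ∈ V := by
      refine ih _ (I.smul_mem _ (I.add_mem ha hθa)) fun j hj => ?_
      by_cases hji : j = i
      · subst hji
        rw [map_smul, map_add, hθ, add_comm]
      · rw [map_smul, map_add, twistedConj_comm hσσ hσx hxx hanti hji, h j (by simp [hji, hj])]
    have hq : (2 : k)⁻¹ • (x i * (a - θ a)) ∈ V := by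
      refine ih _ (I.smul_mem _ (hIl i _ (I.sub_mem ha hθa))) fun j hj => ?_
      by_cases hji : j = i
      · subst hji
        rw [map_smul, map_mul, map_sub, hθ, twistedConj_generator_self hσx hxx, neg_mul,
          ← mul_neg, neg_sub]
      · rw [map_smul, map_mul, map_sub, twistedConj_comm hσσ hσx hxx hanti hji,
          h j (by simp [hji, hj]), twistedConj_generator_of_ne hσx hxx hanti hji]
    have hsum : a = (2 : k)⁻¹ • (a + θ a) + x i * ((2 : k)⁻¹ • (x i * (a - θ a))) := by
      rw [mul_smul_comm, ← mul_assoc, hxx, one_mul, ← smul_add, add_add_sub_cancel, ← two_smul k,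
        smul_smul, inv_mul_cancel₀ h2, one_smul]
    rw [hsum]
    exact V.add_mem hp (hxV i _ hq)

theorem mul_adjoin_le_adjoin_mul {σ : A →ₐ[k] A} {x : ι → A} (hσσ : ∀ a, σ (σ a) = a)
    {J : Submodule k A} (hJσ : ∀ a ∈ J, σ a ∈ J)
    (hJB : J ≤ Subalgebra.toSubmodule (supercentralizer σ x)) :
    J * Subalgebra.toSubmodule (Algebra.adjoin k (Set.range x)) ≤
      Subalgebra.toSubmodule (Algebra.adjoin k (Set.range x)) * J := by
  rw [Submodule.mul_le]
  intro j hj c hc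
  refine Algebra.mul_mem_of_mem_adjoin_right ?_ hc j ?_
  · rintro _ ⟨i, rfl⟩ m hm
    induction hm using Submodule.mul_induction_on' with
    | mem_mul_mem c hc j hj =>
      have h := hJB (hJσ j hj) i
      rw [hσσ] at h
      rw [mul_assoc, ← h, ← mul_assoc]
      exact Submodule.mul_mem_mul (Subalgebra.mul_mem _ hc (Algebra.subset_adjoin ⟨i, rfl⟩)) (hJσ j hj)
    | add a _ b _ ha hb => rw [add_mul]; exact Submodule.add_mem _ ha hb
  · rw [← one_mul j]
    exact Submodule.mul_mem_mul (Subalgebra.one_mem _) hj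

theorem adjoin_image_mul_insert_le [DecidableEq ι] {x : ι → A} (hxx : ∀ i, x i * x i = 1)
    (hanti : ∀ i j, i ≠ j → x i * x j = -(x j * x i)) (J : Submodule k A) {i : ι} {s : Finset ι}
    (his : i ∉ s) :
    Subalgebra.toSubmodule (Algebra.adjoin k (x '' (insert i s : Finset ι))) * J ≤
      Subalgebra.toSubmodule (Algebra.adjoin k (x '' s)) * J ⊔
      (Subalgebra.toSubmodule (Algebra.adjoin k (x '' s)) * J).map (LinearMap.mulLeft k (x i)) := by
  set V := Subalgebra.toSubmodule (Algebra.adjoin k (x '' s)) * J with hV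
  have hxV : ∀ j ∈ s, ∀ v ∈ V, x j * v ∈ V := by
    intro j hj v hv
    have h : x j * v ∈ Subalgebra.toSubmodule (Algebra.adjoin k (x '' s)) * V :=
      Submodule.mul_mem_mul (Algebra.subset_adjoin ⟨j, hj, rfl⟩) hv
    rwa [hV, ← mul_assoc, (Subalgebra.isIdempotentElem_toSubmodule _).eq] at h
  rw [Submodule.mul_le]
  intro c hc j hj
  refine Algebra.mul_mem_of_mem_adjoin_left ?_ hc j ?_
  · rintro _ ⟨l, hl, rfl⟩ m hm
    obtain ⟨p, hp, _, ⟨q, hq, rfl⟩, rfl⟩ := Submodule.mem_sup.1 hm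
    rw [mul_add, LinearMap.mulLeft_apply]
    rcases Finset.mem_insert.1 hl with rfl | hls
    · rw [← mul_assoc, hxx, one_mul]
      exact Submodule.add_mem _ (Submodule.mem_sup_right ⟨p, hp, rfl⟩)
        (Submodule.mem_sup_left hq)
    · have hli : l ≠ i := fun h => his (h ▸ hls)
      rw [← mul_assoc, hanti l i hli, neg_mul, ← mul_neg, mul_assoc]
      refine Submodule.add_mem _ (Submodule.mem_sup_left (hxV l hls p hp))
        (Submodule.mem_sup_right ?_)
      exact ⟨x l * -q, hxV l hls _ (V.neg_mem hq), by simp⟩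
  · refine Submodule.mem_sup_left ?_
    rw [← one_mul j]
    exact Submodule.mul_mem_mul (Subalgebra.one_mem _) hj

theorem adjoin_mul_inf_supercentralizer_le [Finite ι] (h2 : (2 : k) ≠ 0)
    {σ : A →ₐ[k] A} {x : ι → A} (hσx : ∀ i, σ (x i) = -x i)
    (hxx : ∀ i, x i * x i = 1) (hanti : ∀ i j, i ≠ j → x i * x j = -(x j * x i))
    {J : Submodule k A} (hJB : J ≤ Subalgebra.toSubmodule (supercentralizer σ x)) :
    (Subalgebra.toSubmodule (Algebra.adjoin k (Set.range x)) * J) ⊓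
      Subalgebra.toSubmodule (supercentralizer σ x) ≤ J := by
  classical
  have := Fintype.ofFinite ι
  rintro a ⟨ha, haB⟩
  suffices key : ∀ s : Finset ι,
      a ∈ Subalgebra.toSubmodule (Algebra.adjoin k (x '' s)) * J → a ∈ J from
    key Finset.univ (by simpa using ha)
  intro s
  induction s using Finset.induction_on with
  | empty =>
    intro h
    rwa [Finset.coe_empty, Set.image_empty, Algebra.adjoin_empty, Algebra.toSubmodule_bot,
      Submodule.one_mul] at h
  | insert i s his ih =>
    intro h
    obtain ⟨p, hp, _, ⟨q, hq, rfl⟩, rfl⟩ :=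
      Submodule.mem_sup.1 (adjoin_image_mul_insert_le hxx hanti J his h)
    set θ := twistedConj σ (x i) (hxx i)
    have hfix : ∀ v ∈ Subalgebra.toSubmodule (Algebra.adjoin k (x '' s)) * J, θ v = v := by
      intro v hv
      have hC : Algebra.adjoin k (x '' s) ≤ AlgHom.equalizer θ (AlgHom.id k A) := by
        refine Algebra.adjoin_le ?_
        rintro _ ⟨j, hj, rfl⟩
        exact twistedConj_generator_of_ne hσx hxx hanti (fun h => his (h ▸ hj))
      induction hv using Submodule.mul_induction_on' with
      | mem_mul_mem c hc j hj =>
        have hc' : θ c = c := hC hc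
        rw [map_mul, hc', (twistedConj_eq_self_iff σ _ (hxx i) j).2 (hJB hj i)]
      | add a _ b _ ha hb => rw [map_add, ha, hb]
    have hθ := (twistedConj_eq_self_iff σ _ (hxx i) _).2 (haB i)
    rw [LinearMap.mulLeft_apply] at hθ
    have hθ' : p + -x i * q = p + x i * q := by
      rw [← hθ]
      change _ = θ (p + x i * q)
      rw [map_add, map_mul, hfix p hp, hfix q hq, twistedConj_generator_self hσx hxx]
    have hq0 : x i * q = 0 := by
      have h3 : (2 : k) • (x i * q) = 0 := by
        rw [two_smul]
        nth_rewrite 1 [← add_left_cancel hθ']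
        rw [neg_mul, neg_add_cancel]
      exact (smul_eq_zero.1 h3).resolve_left h2
    refine ih ?_
    rw [LinearMap.mulLeft_apply, hq0, add_zero]
    exact hp

/-- The parity automorphism of a `ℤ/2`-graded algebra. -/
theorem exists_parity_algHom {A0 A1 : Submodule k A} (hc : IsCompl A0 A1)
    (h00 : ∀ a ∈ A0, ∀ b ∈ A0, a * b ∈ A0)
    (h01 : ∀ a ∈ A0, ∀ b ∈ A1, a * b ∈ A1)
    (h10 : ∀ a ∈ A1, ∀ b ∈ A0, a * b ∈ A1)
    (h11 : ∀ a ∈ A1, ∀ b ∈ A1, a * b ∈ A0)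
    (hone : (1 : A) ∈ A0) :
    ∃ σ : A →ₐ[k] A, (∀ a ∈ A0, σ a = a) ∧ ∀ a ∈ A1, σ a = -a := by
  let f : A →ₗ[k] A := LinearMap.ofIsCompl hc A0.subtype (-A1.subtype)
  have f0 : ∀ a ∈ A0, f a = a := fun a ha => LinearMap.ofIsCompl_apply_left hc (⟨a, ha⟩ : A0)
  have f1 : ∀ a ∈ A1, f a = -a := fun a ha => LinearMap.ofIsCompl_apply_right hc (⟨a, ha⟩ : A1)
  refine ⟨AlgHom.ofLinearMap f (f0 1 hone) ?_, f0, f1⟩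
  intro a b
  obtain ⟨a0, ha0, a1, ha1, rfl⟩ := Submodule.mem_sup.1 (hc.sup_eq_top ▸ Submodule.mem_top (x := a))
  obtain ⟨b0, hb0, b1, hb1, rfl⟩ := Submodule.mem_sup.1 (hc.sup_eq_top ▸ Submodule.mem_top (x := b))
  simp only [add_mul, mul_add, map_add, f0 _ ha0, f0 _ hb0, f1 _ ha1, f1 _ hb1,
    f0 _ (h00 _ ha0 _ hb0), f1 _ (h01 _ ha0 _ hb1), f1 _ (h10 _ ha1 _ hb0), f0 _ (h11 _ ha1 _ hb1)]
  noncomm_ring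

theorem eq_supercentralizer {A0 A1 : Submodule k A} (hc : IsCompl A0 A1)
    (h01 : ∀ a ∈ A0, ∀ b ∈ A1, a * b ∈ A1)
    (h10 : ∀ a ∈ A1, ∀ b ∈ A0, a * b ∈ A1)
    (h11 : ∀ a ∈ A1, ∀ b ∈ A1, a * b ∈ A0)
    {σ : A →ₐ[k] A} (σ0 : ∀ a ∈ A0, σ a = a) (σ1 : ∀ a ∈ A1, σ a = -a)
    {x : ι → A} (hx1 : ∀ i, x i ∈ A1) {B : Subalgebra k A}
    (hB : Subalgebra.toSubmodule B =
        (A0 ⊓ ⨅ i, LinearMap.ker (LinearMap.mulLeft k (x i) - LinearMap.mulRight k (x i))) ⊔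
        (A1 ⊓ ⨅ i, LinearMap.ker (LinearMap.mulLeft k (x i) + LinearMap.mulRight k (x i)))) :
    B = supercentralizer σ x := by
  apply Subalgebra.toSubmodule_injective
  rw [hB]
  apply le_antisymm
  · refine sup_le ?_ ?_
    · rintro a ⟨ha, hk⟩ i
      have h := (Submodule.mem_iInf _).1 hk i
      rw [σ0 a ha]
      simpa [sub_eq_zero] using h
    · rintro a ⟨ha, hk⟩ i
      have h := (Submodule.mem_iInf _).1 hk i
      rw [σ1 a ha, neg_mul]
      simpa [add_eq_zero_iff_eq_neg] using h
  · intro a ha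
    obtain ⟨a0, ha0, a1, ha1, rfl⟩ :=
      Submodule.mem_sup.1 (hc.sup_eq_top ▸ Submodule.mem_top (x := a))
    have key : ∀ i, x i * a0 - a0 * x i = 0 ∧ x i * a1 + a1 * x i = 0 := by
      intro i
      have h := ha i
      rw [map_add, σ0 _ ha0, σ1 _ ha1] at h
      have he : x i * a0 - a0 * x i = -(x i * a1 + a1 * x i) := by
        rw [← sub_eq_zero] at h ⊢
        rw [← h]
        noncomm_ring
      have hm1 : x i * a0 - a0 * x i ∈ A1 :=
        A1.sub_mem (h10 _ (hx1 i) _ ha0) (h01 _ ha0 _ (hx1 i))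
      have hm0 : x i * a1 + a1 * x i ∈ A0 :=
        A0.add_mem (h11 _ (hx1 i) _ ha1) (h11 _ ha1 _ (hx1 i))
      have hz := Submodule.disjoint_def.1 hc.disjoint _ (he ▸ A0.neg_mem hm0) hm1
      exact ⟨hz, by rwa [hz, eq_comm, neg_eq_zero] at he⟩
    refine Submodule.add_mem_sup ⟨ha0, ?_⟩ ⟨ha1, ?_⟩
    · exact (Submodule.mem_iInf _).2 fun i => (key i).1
    · exact (Submodule.mem_iInf _).2 fun i => (key i).2

theorem exists_even_add_odd (h2 : (2 : k) ≠ 0) {A0 A1 : Submodule k A} (hc : IsCompl A0 A1)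
    {σ : A →ₐ[k] A} (σ0 : ∀ a ∈ A0, σ a = a) (σ1 : ∀ a ∈ A1, σ a = -a)
    {N : Submodule k A} (hN : ∀ a ∈ N, σ a ∈ N) {a : A} (ha : a ∈ N) :
    ∃ a0 ∈ N, ∃ a1 ∈ N, a0 ∈ A0 ∧ a1 ∈ A1 ∧ a = a0 + a1 := by
  obtain ⟨a0, ha0, a1, ha1, rfl⟩ := Submodule.mem_sup.1 (hc.sup_eq_top ▸ Submodule.mem_top (x := a))
  have hσ := hN _ ha
  rw [map_add, σ0 _ ha0, σ1 _ ha1] at hσ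
  have e0 : a0 = (2 : k)⁻¹ • (a0 + a1 + (a0 + -a1)) := by
    rw [add_add_add_comm, add_neg_cancel, add_zero, ← two_smul k, smul_smul, inv_mul_cancel₀ h2,
      one_smul]
  have m0 : a0 ∈ N := e0 ▸ N.smul_mem _ (N.add_mem ha hσ)
  exact ⟨a0, m0, a1, by simpa using N.sub_mem ha m0, ha0, ha1, rfl⟩

end Supercentralizer


/-- For pairwise anticommuting odd square-one elements `x₁, …, xₙ`, every graded
two-sided ideal `Ĩ` of `A` equals the `k`-linear span of `{c·b : c ∈ C, b ∈ Ĩ ∩ B}`, where `C`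
is the unital subalgebra generated by `x₁, …, xₙ` and `B` is the joint supercentralizer; moreover
`Ĩ ↦ Ĩ ∩ B` is a bijection from the set of graded two-sided ideals of `A` onto the set of graded
two-sided ideals of `B`. -/
theorem graded_ideal_span_and_bijection
    (k A : Type*) [Field k] [Ring A] [Algebra k A]
    (h2 : (2 : k) ≠ 0)
    (A0 A1 : Submodule k A)
    (hsup : A0 ⊔ A1 = ⊤) (hinf : A0 ⊓ A1 = ⊥)
    (h00 : ∀ a ∈ A0, ∀ b ∈ A0, a * b ∈ A0)
    (h01 : ∀ a ∈ A0, ∀ b ∈ A1, a * b ∈ A1)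
    (h10 : ∀ a ∈ A1, ∀ b ∈ A0, a * b ∈ A1)
    (h11 : ∀ a ∈ A1, ∀ b ∈ A1, a * b ∈ A0)
    (hone : (1 : A) ∈ A0)
    (n : ℕ) (x : Fin n → A)
    (hx1 : ∀ i, x i ∈ A1) (hxx : ∀ i, x i * x i = 1)
    (hanti : ∀ i j, i ≠ j → x i * x j = -(x j * x i))
    -- `B` is the joint supercentralizer of `x₁, …, xₙ`
    (B : Subalgebra k A)
    (hB : Subalgebra.toSubmodule B =
        (A0 ⊓ ⨅ i, LinearMap.ker (LinearMap.mulLeft k (x i) - LinearMap.mulRight k (x i))) ⊔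
        (A1 ⊓ ⨅ i, LinearMap.ker (LinearMap.mulLeft k (x i) + LinearMap.mulRight k (x i))))
    -- `C` is the unital subalgebra generated by `x₁, …, xₙ`
    (C : Subalgebra k A) (hC : C = Algebra.adjoin k (Set.range x))
    -- the gradedness conditions on two-sided ideals of `A` and of `B`
    (gradedA : TwoSidedIdeal A → Prop)
    (hgradedA : ∀ I, gradedA I ↔
      ∀ a ∈ I, ∃ a0 ∈ I, ∃ a1 ∈ I, a0 ∈ A0 ∧ a1 ∈ A1 ∧ a = a0 + a1)
    (gradedB : TwoSidedIdeal B → Prop)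
    (hgradedB : ∀ J, gradedB J ↔
      ∀ b ∈ J, ∃ b0 ∈ J, ∃ b1 ∈ J, ((b0 : A) ∈ A0) ∧ ((b1 : A) ∈ A1) ∧ b = b0 + b1) :
    -- every graded two-sided ideal of `A` is spanned by `{c·b : c ∈ C, b ∈ Ĩ ∩ B}`
    (∀ I : TwoSidedIdeal A, gradedA I →
      (I : Set A) =
        ↑(Submodule.span k {a : A | ∃ c ∈ C, ∃ b : B, (b : A) ∈ I ∧ a = c * (b : A)})) ∧
    -- `Ĩ ↦ Ĩ ∩ B` is well defined on graded ideals
    (∀ I : TwoSidedIdeal A, gradedA I →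
      ∃ J : TwoSidedIdeal B, gradedB J ∧ (J : Set B) = {b : B | (b : A) ∈ I}) ∧
    -- injectivity
    (∀ I I' : TwoSidedIdeal A, gradedA I → gradedA I' →
      {b : B | (b : A) ∈ I} = {b : B | (b : A) ∈ I'} → I = I') ∧
    -- surjectivity onto graded two-sided ideals of `B`
    (∀ J : TwoSidedIdeal B, gradedB J →
      ∃ I : TwoSidedIdeal A, gradedA I ∧ {b : B | (b : A) ∈ I} = (J : Set B)) := by
  have hc : IsCompl A0 A1 := IsCompl.of_eq hinf hsup
  obtain ⟨σ, σ0, σ1⟩ := exists_parity_algHom hc h00 h01 h10 h11 hone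
  have hσx : ∀ i, σ (x i) = -x i := fun i => σ1 _ (hx1 i)
  have hσσ : ∀ a, σ (σ a) = a := by
    intro a
    obtain ⟨a0, ha0, a1, ha1, rfl⟩ := Submodule.mem_sup.1 (hsup ▸ Submodule.mem_top (x := a))
    simp [σ0 _ ha0, σ1 _ ha1]
  obtain rfl := eq_supercentralizer hc h01 h10 h11 σ0 σ1 hx1 hB
  subst hC
  set B := supercentralizer σ x
  set C := Algebra.adjoin k (Set.range x)
  let toSub : TwoSidedIdeal A → Submodule k A := fun I => I.asIdeal.restrictScalars k
  have mem_toSub : ∀ I a, a ∈ toSub I ↔ a ∈ I := fun I a => TwoSidedIdeal.mem_asIdeal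
  have σI : ∀ I, gradedA I → ∀ a ∈ toSub I, σ a ∈ toSub I := by
    intro I hI a ha
    obtain ⟨a0, h0, a1, h1, e0, e1, rfl⟩ := (hgradedA I).1 hI a ((mem_toSub I a).1 ha)
    rw [map_add, σ0 _ e0, σ1 _ e1]
    exact (toSub I).add_mem ((mem_toSub I _).2 h0) ((toSub I).neg_mem ((mem_toSub I _).2 h1))
  have span : ∀ I : TwoSidedIdeal A, gradedA I → (I : Set A) =
      ↑(Submodule.span k {a : A | ∃ c ∈ C, ∃ b : B, (b : A) ∈ I ∧ a = c * (b : A)}) := by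
    intro I hI
    apply Set.Subset.antisymm
    · intro a ha
      have h := le_adjoin_mul_inf_supercentralizer h2 hσσ hσx hxx hanti (σI I hI)
        (fun i a ha => (mem_toSub I _).2 (I.mul_mem_left _ _ ((mem_toSub I a).1 ha)))
        (fun i a ha => (mem_toSub I _).2 (I.mul_mem_right _ _ ((mem_toSub I a).1 ha)))
        ((mem_toSub I a).2 ha)
      refine (Submodule.mul_le.2 ?_) h
      rintro c hc b ⟨hbI, hbB⟩
      exact Submodule.subset_span ⟨c, hc, ⟨b, hbB⟩, (mem_toSub I b).1 hbI, rfl⟩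
    · suffices h : Submodule.span k
          {a : A | ∃ c ∈ C, ∃ b : B, (b : A) ∈ I ∧ a = c * (b : A)} ≤ toSub I from
        fun a ha => (mem_toSub I a).1 (h ha)
      rw [Submodule.span_le]
      rintro _ ⟨c, _, b, hb, rfl⟩
      exact (mem_toSub I _).2 (I.mul_mem_left _ _ hb)
  refine ⟨span, ?_, ?_, ?_⟩
  · intro I hI
    refine ⟨I.comap B.val, ?_, ?_⟩
    · rw [hgradedB]
      intro b hb
      obtain ⟨b0, ⟨m0, n0⟩, b1, ⟨m1, n1⟩, e0, e1, he⟩ := exists_even_add_odd h2 hc σ0 σ1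
        (N := toSub I ⊓ Subalgebra.toSubmodule B)
        (fun a ha => ⟨σI I hI a ha.1, map_mem_supercentralizer hσx ha.2⟩)
        (a := b) ⟨(mem_toSub I _).2 ((TwoSidedIdeal.mem_comap _).1 hb), b.2⟩
      exact ⟨⟨b0, n0⟩, (TwoSidedIdeal.mem_comap _).2 ((mem_toSub I _).1 m0), ⟨b1, n1⟩,
        (TwoSidedIdeal.mem_comap _).2 ((mem_toSub I _).1 m1), e0, e1, Subtype.ext he⟩
    · ext b
      exact TwoSidedIdeal.mem_comap _
  · intro I I' hI hI' h
    apply SetLike.coe_injective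
    rw [span I hI, span I' hI']
    have h' : ∀ b : B, (b : A) ∈ I ↔ (b : A) ∈ I' := fun b => Set.ext_iff.1 h b
    simp only [h']
  · intro J hJ
    let K : Submodule k A := (J.asIdeal.restrictScalars k).map B.val.toLinearMap
    have mem_K : ∀ b : B, (b : A) ∈ K ↔ b ∈ J := by
      intro b
      constructor
      · rintro ⟨b', hb', h⟩
        obtain rfl : b' = b := Subtype.ext h
        exact TwoSidedIdeal.mem_asIdeal.1 hb'
      · exact fun h => ⟨b, TwoSidedIdeal.mem_asIdeal.2 h, rfl⟩
    have hKB : K ≤ Subalgebra.toSubmodule B := by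
      rintro _ ⟨b, _, rfl⟩
      exact b.2
    have hKσ : ∀ a ∈ K, σ a ∈ K := by
      intro a ha
      obtain ⟨b, rfl⟩ : ∃ b : B, (b : A) = a := ⟨⟨a, hKB ha⟩, rfl⟩
      obtain ⟨b0, m0, b1, m1, e0, e1, rfl⟩ := (hgradedB J).1 hJ b ((mem_K b).1 ha)
      have h : σ ((b0 + b1 : B) : A) = ((b0 - b1 : B) : A) := by
        simp [σ0 _ e0, σ1 _ e1, sub_eq_add_neg]
      rw [h, mem_K]
      exact J.sub_mem m0 m1
    have hBK : Subalgebra.toSubmodule B * K ≤ K := by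
      rw [Submodule.mul_le]
      intro b hb a ha
      exact (mem_K (⟨b, hb⟩ * ⟨a, hKB ha⟩)).2 (J.mul_mem_left _ _ ((mem_K ⟨a, hKB ha⟩).1 ha))
    have hKB' : K * Subalgebra.toSubmodule B ≤ K := by
      rw [Submodule.mul_le]
      intro a ha b hb
      exact (mem_K (⟨a, hKB ha⟩ * ⟨b, hb⟩)).2 (J.mul_mem_right _ _ ((mem_K ⟨a, hKB ha⟩).1 ha))
    have htop : (⊤ : Submodule k A) ≤ Subalgebra.toSubmodule C * Subalgebra.toSubmodule B := by
      have h := le_adjoin_mul_inf_supercentralizer (I := ⊤) h2 hσσ hσx hxx hanti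
        (by simp) (by simp) (by simp)
      rwa [top_inf_eq] at h
    have hBC : Subalgebra.toSubmodule B * Subalgebra.toSubmodule C ≤
        Subalgebra.toSubmodule C * Subalgebra.toSubmodule B :=
      mul_adjoin_le_adjoin_mul hσσ (fun a ha => map_mem_supercentralizer hσx ha) le_rfl
    have hKC : K * Subalgebra.toSubmodule C ≤ Subalgebra.toSubmodule C * K :=
      mul_adjoin_le_adjoin_mul hσσ hKσ hKB
    set C' := Subalgebra.toSubmodule C
    set B' := Subalgebra.toSubmodule B
    have hCC : C' * C' = C' := Subalgebra.isIdempotentElem_toSubmodule C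
    have hleft : ⊤ * (C' * K) ≤ C' * K := calc
      ⊤ * (C' * K) ≤ C' * B' * (C' * K) := mul_le_mul_left htop _
      _ = C' * (B' * C') * K := by simp only [mul_assoc]
      _ ≤ C' * (C' * B') * K := by gcongr
      _ = C' * C' * (B' * K) := by simp only [mul_assoc]
      _ ≤ C' * K := by rw [hCC]; gcongr
    have hright : (C' * K) * ⊤ ≤ C' * K := calc
      (C' * K) * ⊤ ≤ C' * K * (C' * B') := by gcongr
      _ = C' * (K * C') * B' := by simp only [mul_assoc]
      _ ≤ C' * (C' * K) * B' := by gcongr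
      _ = C' * C' * (K * B') := by simp only [mul_assoc]
      _ ≤ C' * K := by rw [hCC]; gcongr
    have hσM : ∀ a ∈ C' * K, σ a ∈ C' * K := by
      have hσC : C ≤ C.comap σ := by
        refine Algebra.adjoin_le ?_
        rintro _ ⟨i, rfl⟩
        change σ (x i) ∈ C
        rw [hσx]
        exact neg_mem (Algebra.subset_adjoin ⟨i, rfl⟩)
      intro a ha
      induction ha using Submodule.mul_induction_on' with
      | mem_mul_mem c hc j hj =>
        rw [map_mul]
        exact Submodule.mul_mem_mul (hσC hc) (hKσ j hj)
      | add a _ b _ ha hb => rw [map_add]; exact Submodule.add_mem _ ha hb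
    let I : TwoSidedIdeal A := TwoSidedIdeal.mk' (C' * K : Submodule k A)
      (zero_mem _) (fun ha hb => add_mem ha hb) (fun ha => neg_mem ha)
      (fun ha => hleft (Submodule.mul_mem_mul Submodule.mem_top ha))
      (fun ha => hright (Submodule.mul_mem_mul ha Submodule.mem_top))
    have mem_I : ∀ a, a ∈ I ↔ a ∈ C' * K := fun a => TwoSidedIdeal.mem_mk' ..
    refine ⟨I, ?_, ?_⟩
    · rw [hgradedA]
      intro a ha
      simp only [mem_I] at ha ⊢
      exact exists_even_add_odd h2 hc σ0 σ1 hσM ha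
    · ext b
      change (b : A) ∈ I ↔ b ∈ J
      rw [mem_I, ← mem_K]
      constructor
      · exact fun h => adjoin_mul_inf_supercentralizer_le h2 hσx hxx hanti hKB ⟨h, b.2⟩
      · intro h
        rw [← one_mul (b : A)]
        exact Submodule.mul_mem_mul (one_mem C) h
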